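/- Let E ⊆ A be an extension-closed full subcategory of an abelian category, with enough projectives ω that are self-orthogonal in A. If T ∈ ω and X ∈ E satisfies dell_E(X) = d < ∞, then Ext²_A(T, X) = 0. -/

import Mathlib

universe w v u

open CategoryTheory Limits ZeroObject

section ExactSub

variable (C : Type u) [Category.{v} C] [Abelian C]

/-- A short exact sequence `0 → X → Y → Z → 0` in the abelian category `C`. -/
def cSES (X Y Z : C) : Prop :=
  ∃ (i : X ⟶ Y) (p : Y ⟶ Z) (w : i ≫ p = 0),
    Mono i ∧ Epi p ∧ (ShortComplex.mk i p w).Exact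

/-- `X` is a direct summand (retract) of `Y`. -/
def cretract (X Y : C) : Prop := ∃ (s : X ⟶ Y) (r : Y ⟶ X), s ≫ r = 𝟙 X

/-- `Q` is a projective object of the exact category given by the extension-closed
full subcategory with object class `P`: every conflation ends in a `Q`-epimorphism. -/
def projIn (P : C → Prop) (Q : C) : Prop :=
  P Q ∧ ∀ (X Y Z : C) (i : X ⟶ Y) (p : Y ⟶ Z) (w : i ≫ p = 0),
    Mono i → Epi p → (ShortComplex.mk i p w).Exact → P X → P Y → P Z →
    ∀ g : Q ⟶ Z, ∃ h : Q ⟶ Y, h ≫ p = g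

/-- `SyzChain C P W n X K` says that `K` is an `n`-th syzygy of `X` obtained from a
chain of conflations in the subcategory `P` with middle terms in the class `W` of
projective objects. -/
def SyzChain (P W : C → Prop) : ℕ → C → C → Prop
  | 0, X, K => Nonempty (X ≅ K)
  | (n + 1), X, K => P K ∧ ∃ (Y Q : C), SyzChain P W n X Y ∧ W Q ∧ cSES C K Q Y

/-- The `n`-fold biproduct of copies of an object. -/
noncomputable def objPow (X : C) : ℕ → C
  | 0 => 0
  | (n + 1) => X ⊞ objPow X n

end ExactSub

namespace DellAux

open CategoryTheory.Abelian Pretriangulated DerivedCategory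

lemma ext_one_zero {C : Type u} [Category.{v} C] [Abelian C] [HasExt.{w} C] (T X : C)
    (hsplit : ∀ (Z : C) (f : X ⟶ Z) (g : Z ⟶ T) (hw : f ≫ g = 0), Mono f → Epi g →
      (ShortComplex.mk f g hw).Exact → ∃ h : T ⟶ Z, h ≫ g = 𝟙 T) :
    Subsingleton (Ext T X 1) := by
  let := HasDerivedCategory.standard C
  refine subsingleton_of_forall_eq 0 fun x => ?_
  ext
  rw [Ext.zero_hom]
  let x' : (singleFunctor C 0).obj T ⟶ ((singleFunctor C 0).obj X)⟦(1 : ℤ)⟧ := x.hom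
  suffices hx : x' = 0 from hx
  obtain ⟨Y, f, g, hd⟩ := distinguished_cocone_triangle₂ x'
  have hle : Y.IsLE 0 := TStructure.t.isLE₂ _ hd 0
    (inferInstanceAs (((singleFunctor C 0).obj X).IsLE 0))
    (inferInstanceAs (((singleFunctor C 0).obj T).IsLE 0))
  have hge : Y.IsGE 0 := TStructure.t.isGE₂ _ hd 0
    (inferInstanceAs (((singleFunctor C 0).obj X).IsGE 0))
    (inferInstanceAs (((singleFunctor C 0).obj T).IsGE 0))
  obtain ⟨Z, ⟨e⟩⟩ := exists_iso_singleFunctor_obj_of_isGE_of_isLE Y 0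
  obtain ⟨f₀, hf₀⟩ := (singleFunctor C 0).map_surjective (f ≫ e.hom)
  obtain ⟨g₀, hg₀⟩ := (singleFunctor C 0).map_surjective (e.inv ≫ g)
  have hfg : f ≫ g = 0 := comp_distTriang_mor_zero₁₂ _ hd
  have hgx : g ≫ x' = 0 := comp_distTriang_mor_zero₂₃ _ hd
  have hw : f₀ ≫ g₀ = 0 := by
    apply (singleFunctor C 0).map_injective
    simp [hf₀, hg₀, hfg]
  have hmono : Mono f₀ := by
    refine Preadditive.mono_of_cancel_zero _ fun {A} a ha => ?_
    apply (singleFunctor C 0).map_injective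
    have h1 : (singleFunctor C 0).map a ≫ f = 0 := by
      rw [← cancel_mono e.hom, Category.assoc, ← hf₀, ← Functor.map_comp, ha]; simp
    obtain ⟨b, hb⟩ := Triangle.coyoneda_exact₂ _ (inv_rot_of_distTriang _ hd)
      ((singleFunctor C 0).map a) h1
    have := TStructure.t.isGE_shift ((singleFunctor C 0).obj T) 0 (-1) 1
    have hb0 : b = 0 := TStructure.t.zero_of_isLE_of_isGE b 0 1 (by lia)
      (inferInstanceAs (((singleFunctor C 0).obj A).IsLE 0)) this
    rw [hb, hb0, Functor.map_zero]; exact zero_comp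
  have hepi : Epi g₀ := by
    refine Preadditive.epi_of_cancel_zero _ fun {A} a ha => ?_
    apply (singleFunctor C 0).map_injective
    have h1 : g ≫ (singleFunctor C 0).map a = 0 := by
      rw [← cancel_epi e.inv, ← Category.assoc, ← hg₀, ← Functor.map_comp, ha]; simp
    obtain ⟨b, hb⟩ := Triangle.yoneda_exact₃ _ hd ((singleFunctor C 0).map a) h1
    have := TStructure.t.isLE_shift ((singleFunctor C 0).obj X) 0 1 (-1)
    have hb0 : b = 0 := TStructure.t.zero_of_isLE_of_isGE b (-1) 0 (by lia) this
      (inferInstanceAs (((singleFunctor C 0).obj A).IsGE 0))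
    rw [hb, hb0, Functor.map_zero]; exact comp_zero
  have hex : (ShortComplex.mk f₀ g₀ hw).Exact := by
    refine ShortComplex.exact_of_f_is_kernel _ ?_
    have key : ∀ (A : C) (a : A ⟶ Z), a ≫ g₀ = 0 → ∃ b : A ⟶ X, b ≫ f₀ = a := by
      intro A a ha
      have h1 : ((singleFunctor C 0).map a ≫ e.inv) ≫ g = 0 := by
        rw [Category.assoc, ← hg₀, ← Functor.map_comp, ha, Functor.map_zero]
      have h2 : ∃ b : (singleFunctor C 0).obj A ⟶ (singleFunctor C 0).obj X,
          (singleFunctor C 0).map a ≫ e.inv = b ≫ f :=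
        Triangle.coyoneda_exact₂ _ hd ((singleFunctor C 0).map a ≫ e.inv) h1
      obtain ⟨b, hb⟩ := h2
      obtain ⟨b, rfl⟩ := (singleFunctor C 0).map_surjective b
      refine ⟨b, ?_⟩
      apply (singleFunctor C 0).map_injective
      rw [Functor.map_comp, hf₀, ← Category.assoc, ← hb]; simp
    exact KernelFork.IsLimit.ofι' _ _ fun {A} a ha =>
      ⟨(key A a ha).choose, (key A a ha).choose_spec⟩
  obtain ⟨h, hh⟩ := hsplit Z f₀ g₀ hw hmono hepi hex
  have : (singleFunctor C 0).map h ≫ e.inv ≫ g = 𝟙 _ := by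
    rw [← hg₀, ← Functor.map_comp, hh]; simp
  rw [← Category.id_comp x', ← this]
  simp [hgx]

section
variable {C : Type u} [Category.{v} C] [Abelian C] [HasExt.{w} C]

lemma shift_fwd {K Q Y T : C} (h : cSES C K Q Y) (n : ℕ) (h1 : Subsingleton (Ext T Y n))
    (h2 : Subsingleton (Ext T Q (n + 1))) : Subsingleton (Ext T K (n + 1)) := by
  obtain ⟨i, p, hw, hi, hp, hex⟩ := h
  have hS : (ShortComplex.mk i p hw).ShortExact := { exact := hex, mono_f := hi, epi_g := hp }
  refine subsingleton_of_forall_eq 0 fun x => ?_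
  obtain ⟨y, hy⟩ := Ext.covariant_sequence_exact₁ T hS x (h2.elim _ _) rfl
  rw [← hy, h1.elim y 0, Ext.zero_comp]

lemma shift_bwd {K Q Y T : C} (h : cSES C K Q Y) (n : ℕ) (h1 : Subsingleton (Ext T K (n + 1)))
    (h2 : Subsingleton (Ext T Q n)) : Subsingleton (Ext T Y n) := by
  obtain ⟨i, p, hw, hi, hp, hex⟩ := h
  have hS : (ShortComplex.mk i p hw).ShortExact := { exact := hex, mono_f := hi, epi_g := hp }
  refine subsingleton_of_forall_eq 0 fun x => ?_
  obtain ⟨y, hy⟩ := Ext.covariant_sequence_exact₃ T hS x rfl (h1.elim _ _)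
  rw [← hy, h2.elim y 0, Ext.zero_comp]

lemma retract_sub {K L T : C} (h : cretract C K L) (n : ℕ) (h1 : Subsingleton (Ext T L n)) :
    Subsingleton (Ext T K n) := by
  obtain ⟨s, r, hsr⟩ := h
  refine subsingleton_of_forall_eq 0 fun x => ?_
  have : (x.comp (Ext.mk₀ s) (add_zero n)).comp (Ext.mk₀ r) (add_zero n) = x := by
    simp [hsr]
  rw [← this, h1.elim (x.comp (Ext.mk₀ s) (add_zero n)) 0, Ext.zero_comp]

lemma biprod_sub {K L T : C} (n : ℕ) (h1 : Subsingleton (Ext T K n))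
    (h2 : Subsingleton (Ext T L n)) : Subsingleton (Ext T (K ⊞ L) n) := by
  refine subsingleton_of_forall_eq 0 fun x => ?_
  have : (x.comp (Ext.mk₀ biprod.fst) (add_zero n)).comp (Ext.mk₀ biprod.inl) (add_zero n) +
    (x.comp (Ext.mk₀ biprod.snd) (add_zero n)).comp (Ext.mk₀ biprod.inr) (add_zero n) = x := by
    simp only [Ext.comp_assoc_of_second_deg_zero, Ext.mk₀_comp_mk₀, ← Ext.comp_add, ← Ext.mk₀_add,
      biprod.total, Ext.comp_mk₀_id]
  rw [← this, h1.elim (x.comp (Ext.mk₀ biprod.fst) (add_zero n)) 0,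
    h2.elim (x.comp (Ext.mk₀ biprod.snd) (add_zero n)) 0, Ext.zero_comp, Ext.zero_comp, add_zero]

lemma chain_iff {P W : C → Prop} {T : C}
    (horth : ∀ Q : C, W Q → ∀ i : ℕ, 1 ≤ i → Subsingleton (Ext T Q i)) (X : C) (m : ℕ)
    (hm : 1 ≤ m) (n : ℕ) (K : C) (h : SyzChain C P W n X K) :
    Subsingleton (Ext T X m) ↔ Subsingleton (Ext T K (m + n)) := by
  induction n generalizing K with
  | zero =>
    obtain ⟨e⟩ := h
    exact ⟨retract_sub ⟨e.inv, e.hom, by simp⟩ m, retract_sub ⟨e.hom, e.inv, by simp⟩ m⟩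
  | succ n ih =>
    obtain ⟨-, Y, Q, hY, hQ, hs⟩ := h
    rw [ih Y hY]
    exact ⟨fun h => shift_fwd hs _ h (horth Q hQ _ (by lia)),
      fun h => shift_bwd hs _ h (horth Q hQ _ (by lia))⟩

end

end DellAux

/-- Let `E ⊆ 𝒜` be an extension-closed full subcategory (object class
`P`) of an abelian category `𝒜` with enough projective objects forming a class `ω = W`
whose objects are self-orthogonal in `𝒜`.  If `T ∈ ω` and `X ∈ E` has finite delooping
level `dell_E(X) = d` (witnessed by `Ω^d_E(X)` being a direct summand of
`Ω^(d+1)_E(X') ⊞ Q` for some `X' ∈ E` and some projective `Q`), then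
`Ext²_𝒜(T, X) = 0`. -/
theorem ext_two_vanishes_of_finite_delooping_level
    (C : Type u) [Category.{v} C] [Abelian C] [HasExt.{w} C]
    (P W : C → Prop)
    (hext : ∀ X Y Z : C, cSES C X Y Z → P X → P Z → P Y)
    (hWP : ∀ Q : C, W Q → projIn C P Q)
    (henough : ∀ X : C, P X → ∃ K Q : C, P K ∧ W Q ∧ cSES C K Q X)
    (horth : ∀ Q Q' : C, W Q → W Q' → ∀ i : ℕ, 1 ≤ i → Subsingleton (Abelian.Ext Q Q' i))
    (T X : C) (hT : W T) (hX : P X) (d : ℕ)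
    (hdell : ∃ K : C, SyzChain C P W d X K ∧
      ∃ (X' K' Q : C), P X' ∧ SyzChain C P W (d + 1) X' K' ∧ W Q ∧
        cretract C K (K' ⊞ Q)) :
    Subsingleton (Abelian.Ext T X 2) := by
  have ho := fun Q hQ => horth T Q hT hQ
  obtain ⟨K, hK, X', K', Q, hX', hK', hQ, hr⟩ := hdell
  have h1 : Subsingleton (Abelian.Ext T X' 1) := by
    apply DellAux.ext_one_zero
    intro Z f g hw hf hg hex
    exact (hWP T hT).2 X' Z T f g hw hf hg hex hX'
      (hext X' Z T ⟨f, g, hw, hf, hg, hex⟩ hX' (hWP T hT).1) (hWP T hT).1 (𝟙 T)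
  have h2 : Subsingleton (Abelian.Ext T K' (2 + d)) := by
    have := (DellAux.chain_iff ho X' 1 le_rfl (d + 1) K' hK').1 h1
    rwa [show 1 + (d + 1) = 2 + d by lia] at this
  rw [DellAux.chain_iff ho X 2 (by lia) d K hK]
  exact DellAux.retract_sub hr _ (DellAux.biprod_sub _ h2 (ho Q hQ _ (by lia)))
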